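/- arXiv:2301.00485 — 5 statements merged into one kernel-verified Lean document; each statement's English description precedes it below -/
import Mathlib

section
/- Fix real numbers p, q > 1 and positive constants M, K₁, K₂, let y₀ be the unique positive solution of M K₁ (p+1) (2y₀)^{(p−1)/2} + M K₂ (q+1) (2y₀)^{(q−1)/2} = 1, and set d̂ := y₀ − M K₁ (2y₀)^{(p+1)/2} − M K₂ (2y₀)^{(q+1)/2}. Then d̂ ≥ y₀ · min{(p−1)/(p+1), (q−1)/(q+1)}; in particular d̂ > 0. -/
/-- Lower bound for the depth `d̂ = y₀ - M K₁ (2y₀)^((p+1)/2) - M K₂ (2y₀)^((q+1)/2)`: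
`d̂ ≥ y₀ * min ((p-1)/(p+1)) ((q-1)/(q+1)) > 0`. -/
theorem dhat_pos (p q M K₁ K₂ y₀ : ℝ) (hp : 1 < p) (hq : 1 < q)
    (hM : 0 < M) (hK₁ : 0 < K₁) (hK₂ : 0 < K₂) (hy₀ : 0 < y₀)
    (hy₀eq : M * K₁ * (p + 1) * (2 * y₀) ^ ((p - 1) / 2)
        + M * K₂ * (q + 1) * (2 * y₀) ^ ((q - 1) / 2) = 1)
    (dhat : ℝ)
    (hdhat : dhat = y₀ - M * K₁ * (2 * y₀) ^ ((p + 1) / 2)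
        - M * K₂ * (2 * y₀) ^ ((q + 1) / 2)) :
    y₀ * min ((p - 1) / (p + 1)) ((q - 1) / (q + 1)) ≤ dhat ∧ 0 < dhat := by
  have hrpow (r : ℝ) : (2 * y₀) ^ ((r + 1) / 2) = (2 * y₀) ^ ((r - 1) / 2) * (2 * y₀) := by
    rw [← Real.rpow_add_one (by positivity)]
    congr 1
    ring
  rw [hrpow, hrpow] at hdhat
  have hA : 0 < (2 * y₀) ^ ((p - 1) / 2) := by positivity
  have hB : 0 < (2 * y₀) ^ ((q - 1) / 2) := by positivity
  generalize (2 * y₀) ^ ((p - 1) / 2) = A at *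
  generalize (2 * y₀) ^ ((q - 1) / 2) = B at *
  have hp₁ : 0 < p + 1 := by linarith
  have hq₁ : 0 < q + 1 := by linarith
  have hmin : 0 < min ((p - 1) / (p + 1)) ((q - 1) / (q + 1)) :=
    lt_min (div_pos (by linarith) hp₁) (div_pos (by linarith) hq₁)
  have hminp := (le_div_iff₀ hp₁).mp (min_le_left ((p - 1) / (p + 1)) ((q - 1) / (q + 1)))
  have hminq := (le_div_iff₀ hq₁).mp (min_le_right ((p - 1) / (p + 1)) ((q - 1) / (q + 1)))
  generalize min ((p - 1) / (p + 1)) ((q - 1) / (q + 1)) = m at *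
  have hdhat_eq : dhat = y₀ * (M * K₁ * A * (p - 1) + M * K₂ * B * (q - 1)) := by
    linear_combination hdhat - y₀ * hy₀eq
  have hle : y₀ * m ≤ dhat := by
    rw [hdhat_eq]
    refine mul_le_mul_of_nonneg_left ?_ hy₀.le
    calc m = M * K₁ * A * (m * (p + 1)) + M * K₂ * B * (m * (q + 1)) := by
          linear_combination -m * hy₀eq
      _ ≤ M * K₁ * A * (p - 1) + M * K₂ * B * (q - 1) := by gcongr
  exact ⟨hle, (mul_pos hy₀ hmin).trans_le hle⟩
end

section
/- Fix real numbers p, q > 1 and positive constants M, K₁, K₂, let y₀ be the unique positive solution of M K₁ (p+1) (2y₀)^{(p−1)/2} + M K₂ (q+1) (2y₀)^{(q−1)/2} = 1, define F₁(y) := y − M K₁ (2y)^{(p+1)/2} − M K₂ (2y)^{(q+1)/2} and d̂ := F₁(y₀). Then for every real c with 0 ≤ c < d̂ there exists a unique y₁ > y₀ such that F₁(y₁) = c. -/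
open Filter Set

theorem hasDerivAt_const_mul_two_mul_rpow {s : ℝ} (hs : 1 < s) (a y : ℝ) :
    HasDerivAt (fun y : ℝ => a * (2 * y) ^ ((s + 1) / 2))
      (a * (s + 1) * (2 * y) ^ ((s - 1) / 2)) y := by
  have h := (((hasDerivAt_id y).const_mul 2).rpow_const (p := (s + 1) / 2)
    (Or.inr (by linarith))).const_mul a
  refine h.congr_deriv ?_
  rw [show (s + 1) / 2 - 1 = (s - 1) / 2 by ring]
  simp only [id]
  ring

theorem tendsto_two_mul_rpow_atTop {r : ℝ} (hr : 0 < r) :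
    Tendsto (fun y : ℝ => (2 * y) ^ r) atTop atTop :=
  (tendsto_rpow_atTop hr).comp (tendsto_id.const_mul_atTop two_pos)

/-- For every `0 ≤ c < d̂ = F₁ y₀`, there is a unique `y₁ > y₀` with `F₁ y₁ = c`,
where `F₁(y) = y - M K₁ (2y)^((p+1)/2) - M K₂ (2y)^((q+1)/2)`. -/
theorem exists_unique_y1 (p q M K₁ K₂ y₀ : ℝ) (hp : 1 < p) (hq : 1 < q)
    (hM : 0 < M) (hK₁ : 0 < K₁) (hK₂ : 0 < K₂) (hy₀ : 0 < y₀)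
    (hy₀eq : M * K₁ * (p + 1) * (2 * y₀) ^ ((p - 1) / 2)
        + M * K₂ * (q + 1) * (2 * y₀) ^ ((q - 1) / 2) = 1)
    (F₁ : ℝ → ℝ)
    (hF₁ : ∀ y : ℝ, F₁ y = y - M * K₁ * (2 * y) ^ ((p + 1) / 2)
        - M * K₂ * (2 * y) ^ ((q + 1) / 2))
    (c : ℝ) (hc0 : 0 ≤ c) (hc : c < F₁ y₀) :
    ∃! y₁ : ℝ, y₀ < y₁ ∧ F₁ y₁ = c := by
  have hderiv (y : ℝ) : HasDerivAt F₁ (1 - M * K₁ * (p + 1) * (2 * y) ^ ((p - 1) / 2)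
      - M * K₂ * (q + 1) * (2 * y) ^ ((q - 1) / 2)) y := by
    rw [funext hF₁]
    exact ((hasDerivAt_id y).sub (hasDerivAt_const_mul_two_mul_rpow hp (M * K₁) y)).sub
      (hasDerivAt_const_mul_two_mul_rpow hq (M * K₂) y)
  have hcont : Continuous F₁ := continuous_iff_continuousAt.2 fun y => (hderiv y).continuousAt
  have hanti : StrictAntiOn F₁ (Ici y₀) := by
    refine strictAntiOn_of_deriv_neg (convex_Ici y₀) hcont.continuousOn fun y hy => ?_
    rw [interior_Ici, mem_Ioi] at hy
    rw [(hderiv y).deriv]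
    have h₁ : M * K₁ * (p + 1) * (2 * y₀) ^ ((p - 1) / 2)
        < M * K₁ * (p + 1) * (2 * y) ^ ((p - 1) / 2) :=
      mul_lt_mul_of_pos_left
        (Real.rpow_lt_rpow (by positivity) (by linarith) (by linarith)) (by positivity)
    have h₂ : M * K₂ * (q + 1) * (2 * y₀) ^ ((q - 1) / 2)
        < M * K₂ * (q + 1) * (2 * y) ^ ((q - 1) / 2) :=
      mul_lt_mul_of_pos_left
        (Real.rpow_lt_rpow (by positivity) (by linarith) (by linarith)) (by positivity)
    linarith
  obtain ⟨Y, hY, hYF⟩ : ∃ Y, y₀ ≤ Y ∧ F₁ Y ≤ 0 := by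
    obtain ⟨Y, hY, hlarge⟩ := ((eventually_ge_atTop y₀).and
      (((tendsto_two_mul_rpow_atTop (r := (p - 1) / 2) (by linarith)).const_mul_atTop
        (show 0 < 2 * (M * K₁) by positivity)).eventually_ge_atTop 1)).exists
    refine ⟨Y, hY, ?_⟩
    have hYpos : 0 < Y := hy₀.trans_le hY
    have hrpow : (2 * Y) ^ ((p + 1) / 2) = (2 * Y) ^ ((p - 1) / 2) * (2 * Y) := by
      rw [← Real.rpow_add_one (by positivity)]
      ring_nf
    have hq_nonneg : 0 ≤ M * K₂ * (2 * Y) ^ ((q + 1) / 2) := by positivity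
    rw [hF₁, hrpow]
    linarith [mul_le_mul_of_nonneg_right hlarge hYpos.le]
  obtain ⟨y₁, hy₁, hFy₁⟩ := intermediate_value_Icc' hY hcont.continuousOn ⟨hYF.trans hc0, hc.le⟩
  refine ⟨y₁, ⟨hy₁.1.lt_of_ne ?_, hFy₁⟩, fun z hz => ?_⟩
  · rintro rfl
    exact hc.ne' hFy₁
  · exact hanti.injOn hz.1.le hy₁.1 (hz.2.trans hFy₁.symm)
end

section
/- Fix real numbers p, q > 1 and positive constants M, K₁, K₂, let y₀ be the unique positive solution of M K₁ (p+1) (2y₀)^{(p−1)/2} + M K₂ (q+1) (2y₀)^{(q−1)/2} = 1, define F₁(y) := y − M K₁ (2y)^{(p+1)/2} − M K₂ (2y)^{(q+1)/2} and d̂ := F₁(y₀). Let 0 ≤ c < d̂ and let y₁ > y₀ be the unique solution of F₁(y₁) = c. Let T ∈ (0, ∞] and let E : [0, T) → ℝ be continuous with E(0) > y₀ and F₁(E(t)) ≤ c for all t ∈ [0, T). Then E(t) ≥ y₁ for all t ∈ [0, T). -/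
open Set

theorem convexOn_const_mul_two_mul_rpow {a r : ℝ} (ha : 0 ≤ a) (hr : 1 ≤ r) :
    ConvexOn ℝ (Ici 0) fun y : ℝ => a * (2 * y) ^ r := by
  have h : ConvexOn ℝ (Ici 0) fun y : ℝ => (a * 2 ^ r) • y ^ r :=
    (convexOn_rpow hr).smul (by positivity)
  refine h.congr fun y hy => ?_
  simp only [smul_eq_mul]
  rw [Real.mul_rpow zero_le_two hy, mul_assoc]

theorem concaveOn_sub_const_mul_two_mul_rpow {a b r s : ℝ} (ha : 0 ≤ a) (hb : 0 ≤ b)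
    (hr : 1 ≤ r) (hs : 1 ≤ s) :
    ConcaveOn ℝ (Ici 0) fun y : ℝ => y - a * (2 * y) ^ r - b * (2 * y) ^ s :=
  ((concaveOn_id (convex_Ici 0)).sub (convexOn_const_mul_two_mul_rpow ha hr)).sub
    (convexOn_const_mul_two_mul_rpow hb hs)

/-- A concave function lies strictly above its value at the right endpoint of an interval
as soon as it does so at the left endpoint. -/
theorem ConcaveOn.lt_of_lt_left {f : ℝ → ℝ} {s : Set ℝ} (hf : ConcaveOn ℝ s f) {x y z : ℝ}
    (hx : x ∈ s) (hz : z ∈ s) (hxy : x < y) (hyz : y < z) (h : f z < f x) : f z < f y := by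
  by_contra! hle
  have hslope := hf.slope_anti_adjacent hx hz hxy hyz
  have hright : 0 ≤ (f z - f y) / (z - y) := div_nonneg (by linarith) (by linarith)
  have hleft : (f y - f x) / (y - x) < 0 := div_neg_of_neg_of_pos (by linarith) (by linarith)
  linarith


/-- If `E` is continuous on `[0, T)` with `E 0 > y₀` and `F₁ (E t) ≤ c` on `[0, T)`,
where `0 ≤ c < d̂ = F₁ y₀` and `y₁ > y₀` is the unique solution of `F₁ y₁ = c`,
then `E t ≥ y₁` on all of `[0, T)`.  Here `T ∈ (0, ∞]` is modelled as an
extended real number. -/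
theorem E_ge_y1 (p q M K₁ K₂ y₀ : ℝ) (hp : 1 < p) (hq : 1 < q)
    (hM : 0 < M) (hK₁ : 0 < K₁) (hK₂ : 0 < K₂) (hy₀ : 0 < y₀)
    (hy₀eq : M * K₁ * (p + 1) * (2 * y₀) ^ ((p - 1) / 2)
        + M * K₂ * (q + 1) * (2 * y₀) ^ ((q - 1) / 2) = 1)
    (F₁ : ℝ → ℝ)
    (hF₁ : ∀ y : ℝ, F₁ y = y - M * K₁ * (2 * y) ^ ((p + 1) / 2)
        - M * K₂ * (2 * y) ^ ((q + 1) / 2))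
    (c : ℝ) (hc0 : 0 ≤ c) (hc : c < F₁ y₀)
    (y₁ : ℝ) (hy₁ : y₀ < y₁) (hy₁eq : F₁ y₁ = c)
    (T : EReal) (hT : 0 < T)
    (E : ℝ → ℝ)
    (hEcont : ContinuousOn E {t : ℝ | 0 ≤ t ∧ (t : EReal) < T})
    (hE0 : y₀ < E 0)
    (hEF : ∀ t : ℝ, 0 ≤ t → (t : EReal) < T → F₁ (E t) ≤ c) :
    ∀ t : ℝ, 0 ≤ t → (t : EReal) < T → y₁ ≤ E t := by
  intro t ht htT
  have hconc : ConcaveOn ℝ (Ici 0) F₁ := by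
    rw [funext hF₁]
    exact concaveOn_sub_const_mul_two_mul_rpow (by positivity) (by positivity)
      (by linarith) (by linarith)
  have hgt : y₀ < E t := by
    by_contra! hle
    have hlt : ∀ s ∈ Icc 0 t, (s : EReal) < T := fun s hs =>
      (EReal.coe_le_coe_iff.mpr hs.2).trans_lt htT
    have hcont : ContinuousOn E (Icc 0 t) := hEcont.mono fun s hs => ⟨hs.1, hlt s hs⟩
    obtain ⟨s, hs, hEs⟩ := intermediate_value_Icc' ht hcont ⟨hle, hE0.le⟩
    have hFs := hEF s hs.1 (hlt s hs)
    rw [hEs] at hFs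
    exact hFs.not_gt hc
  by_contra! hlt
  have hF := hconc.lt_of_lt_left hy₀.le (hy₀.trans hy₁).le hgt hlt (hy₁eq.trans_lt hc)
  rw [hy₁eq] at hF
  exact (hEF t ht htT).not_gt hF
end

section
/- Fix real numbers p, q > 1 and positive constants M, K₁, K₂, and let y₀ be the unique positive solution of M K₁ (p+1) (2y₀)^{(p−1)/2} + M K₂ (q+1) (2y₀)^{(q−1)/2} = 1. If x > 0 satisfies x² < M (p+1) K₁ x^{p+1} + M (q+1) K₂ x^{q+1}, then x² > 2 y₀. -/
theorem Real.rpow_add_one_eq_sq_mul_rpow_half {x : ℝ} (hx : 0 < x) (p : ℝ) :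
    x ^ (p + 1) = x ^ 2 * (x ^ 2) ^ ((p - 1) / 2) := by
  rw [← Real.rpow_natCast x 2, ← Real.rpow_mul hx.le, ← Real.rpow_add hx]
  congr 1
  push_cast
  ring

/-- If `x > 0` satisfies `x² < M (p+1) K₁ x^(p+1) + M (q+1) K₂ x^(q+1)`,
then `x² > 2 y₀`, where `y₀` is the unique positive solution of
`M K₁ (p+1) (2 y₀)^((p-1)/2) + M K₂ (q+1) (2 y₀)^((q-1)/2) = 1`. -/
theorem sq_gt_two_y0 (p q M K₁ K₂ y₀ : ℝ) (hp : 1 < p) (hq : 1 < q)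
    (hM : 0 < M) (hK₁ : 0 < K₁) (hK₂ : 0 < K₂) (hy₀ : 0 < y₀)
    (hy₀eq : M * K₁ * (p + 1) * (2 * y₀) ^ ((p - 1) / 2)
        + M * K₂ * (q + 1) * (2 * y₀) ^ ((q - 1) / 2) = 1)
    (x : ℝ) (hx : 0 < x)
    (hineq : x ^ 2 < M * (p + 1) * K₁ * x ^ (p + 1) + M * (q + 1) * K₂ * x ^ (q + 1)) :
    2 * y₀ < x ^ 2 := by
  by_contra! hle
  have hP : (x ^ 2) ^ ((p - 1) / 2) ≤ (2 * y₀) ^ ((p - 1) / 2) :=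
    Real.rpow_le_rpow (sq_nonneg x) hle (by linarith)
  have hQ : (x ^ 2) ^ ((q - 1) / 2) ≤ (2 * y₀) ^ ((q - 1) / 2) :=
    Real.rpow_le_rpow (sq_nonneg x) hle (by linarith)
  have hsum : M * K₁ * (p + 1) * (x ^ 2) ^ ((p - 1) / 2)
      + M * K₂ * (q + 1) * (x ^ 2) ^ ((q - 1) / 2) ≤ 1 := by
    refine le_of_le_of_eq ?_ hy₀eq
    gcongr
  rw [Real.rpow_add_one_eq_sq_mul_rpow_half hx p,
    Real.rpow_add_one_eq_sq_mul_rpow_half hx q] at hineq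
  linarith [mul_le_mul_of_nonneg_left hsum (sq_nonneg x)]
end

section
/- Let T ∈ (0, ∞], μ > 1 and κ > 0, and let Y : [0, T) → ℝ be differentiable with Y(t) > 0 and Y'(t) ≥ κ · Y(t)^μ for all t ∈ [0, T). Then T is finite and T ≤ Y(0)^{−(μ−1)} / (κ (μ−1)). -/
/-- Blow-up by a differential inequality: if `Y > 0` satisfies
`Y' ≥ κ Y^μ` on `[0, T)` with `μ > 1` and `κ > 0`, then `T` is finite and
`T ≤ Y(0)^(-(μ-1)) / (κ (μ-1))`.  Here `T ∈ (0, ∞]` is an extended real number,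
and differentiability on `[0, T)` is expressed via `HasDerivWithinAt`. -/
theorem blow_up_ode (T : EReal) (hT : 0 < T) (μ κ : ℝ) (hμ : 1 < μ) (hκ : 0 < κ)
    (Y Y' : ℝ → ℝ)
    (hY : ∀ t : ℝ, 0 ≤ t → (t : EReal) < T →
      HasDerivWithinAt Y (Y' t) {s : ℝ | 0 ≤ s ∧ (s : EReal) < T} t)
    (hYpos : ∀ t : ℝ, 0 ≤ t → (t : EReal) < T → 0 < Y t)
    (hYineq : ∀ t : ℝ, 0 ≤ t → (t : EReal) < T → κ * Y t ^ μ ≤ Y' t) :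
    T ≠ ⊤ ∧ T ≤ ((Y 0 ^ (-(μ - 1)) / (κ * (μ - 1)) : ℝ) : EReal) := by
  have key : ∀ t : ℝ, 0 ≤ t → (t : EReal) < T →
      t ≤ Y 0 ^ (-(μ - 1)) / (κ * (μ - 1)) := by
    intro t ht htT
    have hsub : Set.Icc 0 t ⊆ {s : ℝ | 0 ≤ s ∧ (s : EReal) < T} := fun s hs =>
      ⟨hs.1, (EReal.coe_le_coe_iff.2 hs.2).trans_lt htT⟩
    have hderiv : ∀ s ∈ Set.Icc 0 t,
        HasDerivWithinAt (fun s => -Y s ^ (-(μ - 1)) - κ * (μ - 1) * s)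
          (-(Y' s * (-(μ - 1)) * Y s ^ (-(μ - 1) - 1)) - κ * (μ - 1)) (Set.Icc 0 t) s := by
      intro s hs
      obtain ⟨hs0, hsT⟩ := hsub hs
      have hlin : HasDerivWithinAt (fun s => κ * (μ - 1) * s) (κ * (μ - 1)) (Set.Icc 0 t) s := by
        simpa using (hasDerivWithinAt_id s (Set.Icc 0 t)).const_mul (κ * (μ - 1))
      exact ((((hY s hs0 hsT).mono hsub).rpow_const
        (Or.inl (hYpos s hs0 hsT).ne')).neg).sub hlin
    have hmono : MonotoneOn (fun s => -Y s ^ (-(μ - 1)) - κ * (μ - 1) * s) (Set.Icc 0 t) := by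
      refine monotoneOn_of_hasDerivWithinAt_nonneg (convex_Icc 0 t)
        (fun s hs => (hderiv s hs).continuousWithinAt)
        (fun s hs => (hderiv s (interior_subset hs)).mono interior_subset) fun s hs => ?_
      obtain ⟨hs0, hsT⟩ := hsub (interior_subset hs)
      have hpos := hYpos s hs0 hsT
      have hexp : -(μ - 1) - 1 = -μ := by ring
      have hbound : κ ≤ Y' s * Y s ^ (-μ) := by
        rw [Real.rpow_neg hpos.le, ← div_eq_mul_inv, le_div_iff₀ (Real.rpow_pos_of_pos hpos μ)]
        exact hYineq s hs0 hsT
      rw [hexp]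
      nlinarith [mul_nonneg (sub_nonneg.2 hbound) (sub_pos.2 hμ).le]
    have hle := hmono (Set.left_mem_Icc.2 ht) (Set.right_mem_Icc.2 ht) ht
    have hYt := Real.rpow_pos_of_pos (hYpos t ht htT) (-(μ - 1))
    rw [le_div_iff₀ (mul_pos hκ (sub_pos.2 hμ))]
    simp only [mul_zero, sub_zero] at hle
    linarith
  have hT_le : T ≤ ((Y 0 ^ (-(μ - 1)) / (κ * (μ - 1)) : ℝ) : EReal) := by
    by_contra! hlt
    have hB := key 0 le_rfl (by exact_mod_cast hT)
    obtain ⟨t, hBt, htT⟩ := EReal.lt_iff_exists_real_btwn.1 hlt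
    have hBt' := EReal.coe_lt_coe_iff.1 hBt
    exact (key t (hB.trans hBt'.le) htT).not_gt hBt'
  exact ⟨(hT_le.trans_lt (EReal.coe_lt_top _)).ne, hT_le⟩
end
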